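/- For a, b, p, q > 0, ∫₀^∞ ((e^{-aqx} - e^{-apx})/a - (e^{-bqx} - e^{-bpx})/b) / x² dx = (p - q) · ln(b/a). -/

import Mathlib

open MeasureTheory Real Set

open Filter Topology

/-- The Frullani integrand of a continuous function differentiable at `0` is integrable near `0`. -/
theorem integrableOn_Ioc_inv_mul_sub_comp_mul {F : ℝ → ℝ} (hF : Continuous F)
    (hF0 : DifferentiableAt ℝ F 0) (a b : ℝ) :
    IntegrableOn (fun x ↦ x⁻¹ * (F (a * x) - F (b * x))) (Ioc 0 1) := by
  set h : ℝ → ℝ := fun x ↦ F (a * x) - F (b * x) with hh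
  have hcont : Continuous h := by fun_prop
  have hdiff : DifferentiableAt ℝ h 0 := by
    refine DifferentiableAt.sub ?_ ?_ <;>
    · refine DifferentiableAt.comp (g := F) 0 (by simpa using hF0) (by fun_prop)
  have hd : Continuous (dslope h 0) := by
    rw [← continuousOn_univ, continuousOn_dslope univ_mem]
    exact ⟨hcont.continuousOn, hdiff⟩
  have hi : IntegrableOn (dslope h 0) (Ioc 0 1) :=
    (hd.integrableOn_Icc).mono_set Ioc_subset_Icc_self
  refine hi.congr_fun (fun x hx ↦ ?_) measurableSet_Ioc
  rw [dslope_of_ne _ hx.1.ne', slope_def_field]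
  simp [hh, div_eq_inv_mul]

theorem frullani_double_exp (a b p q : ℝ) (ha : 0 < a) (hb : 0 < b) (hp : 0 < p) (hq : 0 < q) :
    ∫ x in Ioi (0:ℝ),
      ((Real.exp (-a * q * x) - Real.exp (-a * p * x)) / a
        - (Real.exp (-b * q * x) - Real.exp (-b * p * x)) / b) / x ^ 2
      = (p - q) * Real.log (b / a) := by
  set g : ℝ → ℝ := fun x ↦ Real.exp (-q * x) - Real.exp (-p * x) with hg
  set F : ℝ → ℝ := dslope g 0 with hF
  have hgd : HasDerivAt g (p - q) 0 := by
    have h (c : ℝ) : HasDerivAt (fun x ↦ Real.exp (-c * x)) (-c) 0 := by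
      simpa using ((hasDerivAt_id (0 : ℝ)).const_mul (-c)).exp
    exact ((h q).sub (h p)).congr_deriv (by ring)
  have hF0 : F 0 = p - q := by rw [hF, dslope_same, hgd.deriv]
  have hFx {x : ℝ} (hx : x ≠ 0) : F x = g x / x := by
    rw [hF, dslope_of_ne _ hx, slope_def_field]
    simp [hg]
  have hFc : Continuous F := by
    rw [← continuousOn_univ, hF, continuousOn_dslope univ_mem]
    exact ⟨by fun_prop, hgd.differentiableAt⟩
  have hFd : DifferentiableAt ℝ F 0 := by
    have hga : AnalyticAt ℝ g 0 := by fun_prop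
    obtain ⟨P, hP⟩ := hga
    exact hP.has_fpower_series_dslope_fslope.differentiableAt
  have heq : EqOn (fun x ↦ ((Real.exp (-a * q * x) - Real.exp (-a * p * x)) / a
        - (Real.exp (-b * q * x) - Real.exp (-b * p * x)) / b) / x ^ 2)
      (fun x ↦ x⁻¹ • (F (a * x) - F (b * x))) (Ioi 0) := by
    intro x (hx : 0 < x)
    have e (c d : ℝ) : -c * (d * x) = -d * c * x := by ring
    simp only [hFx (mul_pos ha hx).ne', hFx (mul_pos hb hx).ne', hg, smul_eq_mul, e]
    field_simp
  have hR : Tendsto F atTop (𝓝 0) := by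
    have h {c : ℝ} (hc : 0 < c) : Tendsto (fun x ↦ Real.exp (-c * x)) atTop (𝓝 0) :=
      Real.tendsto_exp_atBot.comp (tendsto_id.const_mul_atTop_of_neg (neg_lt_zero.2 hc))
    have h' := ((h hq).sub (h hp)).div_atTop tendsto_id
    refine h'.congr' ?_
    filter_upwards [eventually_ne_atTop 0] with x hx using (hFx hx).symm
  have hL : Tendsto F (𝓝[>] 0) (𝓝 (p - q)) :=
    hF0 ▸ hFc.continuousAt.tendsto.mono_left nhdsWithin_le_nhds
  have hint : IntegrableOn (fun x ↦ x⁻¹ • (F (a * x) - F (b * x))) (Ioi 0) := by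
    rw [← Ioc_union_Ioi_eq_Ioi zero_le_one]
    refine (integrableOn_Ioc_inv_mul_sub_comp_mul hFc hFd a b).union ?_
    refine IntegrableOn.congr_fun ?_
      (heq.mono (Ioi_subset_Ioi zero_le_one)) measurableSet_Ioi
    have h {c d : ℝ} (hc : 0 < c) (hd : 0 < d) :
        IntegrableOn (fun x ↦ Real.exp (-c * d * x)) (Ioi 1) := by
      simpa only [neg_mul] using exp_neg_integrableOn_Ioi 1 (mul_pos hc hd)
    have hN := (((h ha hq).sub (h ha hp)).div_const a).sub (((h hb hq).sub (h hb hp)).div_const b)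
    refine hN.mono (Measurable.aestronglyMeasurable (by fun_prop)) ?_
    filter_upwards [ae_restrict_mem measurableSet_Ioi] with x (hx : 1 < x)
    rw [norm_div]
    refine div_le_self (norm_nonneg _) ?_
    rw [Real.norm_of_nonneg (by positivity)]
    exact one_le_pow₀ hx.le
  rw [setIntegral_congr_fun measurableSet_Ioi heq,
    Frullani.integral_Ioi_eq (hFc.locallyIntegrable.locallyIntegrableOn _) ha hb hL hR hint]
  simp [mul_comm]
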